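/- Let n ≥ 1 and write R = R_e ⊕ R_g, where R_e is the ℤ/2-span of the monomials x^a w^{2k} and x^a v w^{2k+1} (0 ≤ a ≤ 2n+1, k ≥ 0) and R_g is the ℤ/2-span of the monomials x^a w^{2k+1} and x^a v w^{2k} (0 ≤ a ≤ 2n+1, k ≥ 0). Suppose (R, Δ) is a char-2 B-V datum such that Δ is homogeneous of degree +1 for the grading deg(x^a v^b w^c) = −a + 2nc, Δ vanishes identically on R_e, Δ(R_g) ⊆ R_g, and Δ(x^{2n+1}·v) = x^{2n}·v. Then Δ(x) = 0, Δ(v) = 0, Δ(w) = 0, {x,v} = v, {v,w} = 0, and either {x,w} = w or {x,w} = w + x^{2n}·v·w². -/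

import Mathlib

open MvPolynomial

noncomputable section

/-- The polynomial ring `(ℤ/2)[x,v,w]`. -/
abbrev P : Type := MvPolynomial (Fin 3) (ZMod 2)

/-- The ideal `(x^{2n+2}, v² + (n+1)·x^{2n}·w)` (the coefficient `n+1` read mod 2). -/
def relIdeal (n : ℕ) : Ideal P :=
  Ideal.span {(X 0 : P) ^ (2 * n + 2),
    (X 1 : P) ^ 2 + C ((n : ZMod 2) + 1) * (X 0 : P) ^ (2 * n) * X 2}

/-- `R = (ℤ/2)[x,v,w]/(x^{2n+2}, v² + (n+1)x^{2n}w) ≅ ℍ_*(L ℝP^{2n+1}; ℤ/2)`. -/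
abbrev R (n : ℕ) : Type := P ⧸ relIdeal n

/-- The quotient map as a `ℤ/2`-algebra homomorphism. -/
def mkR (n : ℕ) : P →ₐ[ZMod 2] R n := Ideal.Quotient.mkₐ (ZMod 2) (relIdeal n)

def x (n : ℕ) : R n := mkR n (X 0)
def v (n : ℕ) : R n := mkR n (X 1)
def w (n : ℕ) : R n := mkR n (X 2)

/-- `R_e`: the `ℤ/2`-span of the monomials `x^a w^{2k}` and `x^a v w^{2k+1}`
with `0 ≤ a ≤ 2n+1`, `k ≥ 0`. -/
def Re (n : ℕ) : Submodule (ZMod 2) (R n) :=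
  Submodule.span (ZMod 2) {y : R n | ∃ a k : ℕ, a ≤ 2 * n + 1 ∧
    (y = x n ^ a * w n ^ (2 * k) ∨ y = x n ^ a * v n * w n ^ (2 * k + 1))}

/-- `R_g`: the `ℤ/2`-span of the monomials `x^a w^{2k+1}` and `x^a v w^{2k}`
with `0 ≤ a ≤ 2n+1`, `k ≥ 0`. -/
def Rg (n : ℕ) : Submodule (ZMod 2) (R n) :=
  Submodule.span (ZMod 2) {y : R n | ∃ a k : ℕ, a ≤ 2 * n + 1 ∧
    (y = x n ^ a * w n ^ (2 * k + 1) ∨ y = x n ^ a * v n * w n ^ (2 * k))}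

/-- The homogeneous component of degree `d` of `R` for the grading
`deg (x^a v^b w^c) = -a + 2nc`. -/
def Rdeg (n : ℕ) (d : ℤ) : Submodule (ZMod 2) (R n) :=
  Submodule.span (ZMod 2) {y : R n | ∃ a b c : ℕ, a ≤ 2 * n + 1 ∧ b ≤ 1 ∧
    y = x n ^ a * v n ^ b * w n ^ c ∧ -(a : ℤ) + 2 * n * c = d}

/-- A commutative ring of characteristic two with a Batalin-Vilkovisky type operator in which
`x ^ (2 * k + 4) = 0`, and in which `Δ v`, `Δ w`, `Δ (x * v)`, `Δ (x * w)` are known up to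
coefficients: the vanishing of `Δ` on `x`, `v * w` and `x * v * w` determines everything but one
coefficient. -/
theorem bv_operator_of_coefficients {A : Type*} [CommRing A] (h2 : (2 : A) = 0) (x v w : A) (k : ℕ)
    (hx : x ^ (2 * k + 4) = 0) (hv : x ^ (2 * k + 2) * v ^ 2 = 0)
    (hne : ∀ c : ℕ, x ^ (2 * k + 3) * v * w ^ c ≠ 0)
    (Δ : A → A) (hΔadd : ∀ a b, Δ (a + b) = Δ a + Δ b) (hΔΔ : ∀ a, Δ (Δ a) = 0)
    (br : A → A → A) (hbr : ∀ a b, br a b = Δ (a * b) + Δ a * b + a * Δ b)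
    (halt : ∀ a, br a a = 0) (hleib : ∀ a b c, br a (b * c) = br a b * c + b * br a c)
    (hΔx : Δ x = 0) (hΔvw : Δ (v * w) = 0) (hΔxvw : Δ (x * (v * w)) = 0)
    (hkey : Δ (x ^ (2 * k + 3) * v) = x ^ (2 * k + 2) * v)
    (hΔv : ∃ ε ε' : A, (ε = 0 ∨ ε = 1) ∧ (ε' = 0 ∨ ε' = 1) ∧
      Δ v = ε * (x ^ (2 * k + 1) * w) + ε' * (x ^ (2 * k + 3) * v * w ^ 2))
    (hΔw : ∃ δ δ' : A, (δ = 0 ∨ δ = 1) ∧ (δ' = 0 ∨ δ' = 1) ∧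
      Δ w = δ * (x ^ (2 * k + 1) * v * w ^ 2) + δ' * (x ^ (2 * k + 3) * w ^ 3))
    (hΔxv : ∃ α β : A, (α = 0 ∨ α = 1) ∧ (β = 0 ∨ β = 1) ∧
      Δ (x * v) = α * v + β * (x ^ (2 * k + 2) * w))
    (hΔxw : ∃ γ ζ : A, (γ = 0 ∨ γ = 1) ∧ (ζ = 0 ∨ ζ = 1) ∧
      Δ (x * w) = γ * w + ζ * (x ^ (2 * k + 2) * v * w ^ 2)) :
    Δ v = 0 ∧ Δ w = 0 ∧ br x v = v ∧ br v w = 0 ∧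
      (br x w = w ∨ br x w = w + x ^ (2 * k + 2) * v * w ^ 2) := by
  have hΔ0 : Δ 0 = 0 := by simpa using hΔadd 0 0
  have hD : ∀ a, br x a = Δ (x * a) + x * Δ a := fun a => by rw [hbr, hΔx]; ring
  have hDx : br x x = 0 := halt x
  have hΔxx : ∀ a, Δ (x * (x * a)) = x * (x * Δ a) := fun a => by
    have h1 := hD (x * a)
    rw [hleib, hDx, hD a] at h1
    linear_combination -h1
  have hΔeven : ∀ (m : ℕ) (a : A), Δ (x ^ (2 * m) * a) = x ^ (2 * m) * Δ a := by
    intro m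
    induction m with
    | zero => simp
    | succ m ih =>
      intro a
      have : x ^ (2 * (m + 1)) * a = x * (x * (x ^ (2 * m) * a)) := by ring
      rw [this, hΔxx, ih]; ring
  have hDpow : ∀ m a, br x (x ^ m * a) = x ^ m * br x a := by
    intro m
    induction m with
    | zero => simp
    | succ m ih =>
      intro a
      rw [pow_succ', mul_assoc, hleib, hDx, ih]; ring
  have hΔodd : ∀ (m : ℕ) (a : A),
      Δ (x ^ (2 * m + 1) * a) = x ^ (2 * m) * (br x a + x * Δ a) := by
    intro m a
    rw [pow_succ, mul_assoc, hΔeven, hD]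
    linear_combination -x ^ (2 * m) * x * Δ a * h2
  obtain ⟨ε, ε', hε, hε', hΔv⟩ := hΔv
  obtain ⟨δ, δ', hδ, hδ', hΔw⟩ := hΔw
  obtain ⟨α, β, hα, hβ, hΔxv⟩ := hΔxv
  obtain ⟨γ, ζ, hγ, hζ, hΔxw⟩ := hΔxw
  have hDv : br x v = α * v + (β + ε) * (x ^ (2 * k + 2) * w) := by
    rw [hD, hΔxv, hΔv]; linear_combination ε' * v * w ^ 2 * hx
  have hDw : br x w = γ * w + (ζ + δ) * (x ^ (2 * k + 2) * v * w ^ 2) := by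
    rw [hD, hΔxw, hΔw]; linear_combination δ' * w ^ 3 * hx
  have hα1 : α = 1 := by
    refine hα.resolve_left fun h0 => hne 0 ?_
    have h1 := hDpow (2 * k + 3) v
    have h3 : x * (x ^ (2 * k + 3) * v) = 0 := by linear_combination v * hx
    rw [hD, hkey, h3, hΔ0, hDv, h0] at h1
    linear_combination h1 + (β + ε) * x ^ (2 * k + 1) * w * hx
  subst hα1
  have hDvw : br x v * w + v * br x w = 0 := by
    rw [← hleib, hD, hΔxvw, hΔvw]; simp
  have hγ1 : γ = 1 := by
    refine hγ.resolve_left fun h0 => hne 1 ?_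
    rw [hDv, hDw, h0] at hDvw
    linear_combination x ^ (2 * k + 3) * hDvw - (β + ε) * x ^ (2 * k + 1) * w ^ 2 * hx
      - (ζ + δ) * x ^ (2 * k + 1) * v ^ 2 * w ^ 2 * hx
  subst hγ1
  have hβε : (β + ε) * (x ^ (2 * k + 2) * w ^ 2) = 0 := by
    rw [hDv, hDw] at hDvw
    linear_combination hDvw - v * w * h2 - (ζ + δ) * w ^ 2 * hv
  have hβε0 : β + ε = 0 := by
    have hne2 : β + ε ≠ 1 := fun h1 => hne 2 (by
      rw [h1] at hβε; linear_combination x * v * hβε)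
    rcases hβ with rfl | rfl <;> rcases hε with rfl | rfl <;> simp at hne2 ⊢
    linear_combination h2
  have hDv' : br x v = v := by rw [hDv, hβε0]; ring
  have hε0 : ε = 0 := by
    refine hε.resolve_right fun h1 => hne 1 ?_
    have h3 := hΔΔ v
    rcases hε' with h0 | h0
    · rw [hΔv, h1, h0, one_mul, zero_mul, add_zero, hΔodd, hDw] at h3
      linear_combination x ^ 3 * v * h3 - (ζ + δ) * x ^ (2 * k + 1) * v ^ 2 * w ^ 2 * hx
        - v * Δ w * hx
    · rw [hΔv, h1, h0, one_mul, one_mul, hΔadd, hΔodd, hDw, mul_assoc (x ^ (2 * k + 3)),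
        show 2 * k + 3 = 2 * (k + 1) + 1 by ring, hΔodd] at h3
      linear_combination x ^ 3 * v * h3 - (ζ + δ) * x ^ (2 * k + 1) * v ^ 2 * w ^ 2 * hx
        - v * Δ w * hx - x * v * (br x (v * w ^ 2) + x * Δ (v * w ^ 2)) * hx
  subst hε0
  have hDww : br x (w * w) = 0 := by
    rw [hleib]; linear_combination w * br x w * h2
  have hDvww : br x (v * w ^ 2) = v * w ^ 2 := by
    rw [pow_two, hleib, hDww, hDv']; ring
  have hDwww : br x (w ^ 3) = w ^ 2 * br x w := by
    rw [show w ^ 3 = w * w * w by ring, hleib, hDww]; ring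
  have hΔv0 : Δ v = 0 := by
    rcases hε' with h0 | h0
    · rw [hΔv, h0]; ring
    · have h3 := hΔΔ v
      rw [hΔv, h0, zero_mul, zero_add, one_mul, mul_assoc (x ^ (2 * k + 3)),
        show 2 * k + 3 = 2 * (k + 1) + 1 by ring, hΔodd, hDvww] at h3
      rw [hΔv, h0]
      linear_combination x * h3 - Δ (v * w ^ 2) * hx
  have hδ0 : δ = 0 := by
    refine hδ.resolve_right fun h1 => hne 2 ?_
    have h3 := hΔΔ w
    rcases hδ' with h0 | h0
    · rw [hΔw, h1, h0, one_mul, zero_mul, add_zero, mul_assoc (x ^ (2 * k + 1)), hΔodd,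
        hDvww] at h3
      linear_combination x ^ 3 * h3 - Δ (v * w ^ 2) * hx
    · rw [hΔw, h1, h0, one_mul, one_mul, hΔadd, mul_assoc (x ^ (2 * k + 1)), hΔodd, hDvww,
        show 2 * k + 3 = 2 * (k + 1) + 1 by ring, hΔodd] at h3
      linear_combination x ^ 3 * h3 - Δ (v * w ^ 2) * hx
        - x * (br x (w ^ 3) + x * Δ (w ^ 3)) * hx
  subst hδ0
  have hΔw0 : Δ w = 0 := by
    rcases hδ' with h0 | h0
    · rw [hΔw, h0]; ring
    · have h3 := hΔΔ w
      rw [hΔw, h0, zero_mul, zero_add, one_mul,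
        show 2 * k + 3 = 2 * (k + 1) + 1 by ring, hΔodd, hDwww, hDw] at h3
      rw [hΔw, h0]
      linear_combination x * h3 - Δ (w ^ 3) * hx - ζ * x ^ (2 * k + 1) * v * w ^ 4 * hx
  refine ⟨hΔv0, hΔw0, hDv', ?_, ?_⟩
  · rw [hbr, hΔvw, hΔv0, hΔw0]; ring
  · rcases hζ with h0 | h0 <;> rw [hDw, h0]
    · left; ring
    · right; ring

theorem x_pow_eq_zero (n : ℕ) : x n ^ (2 * n + 2) = 0 := by
  have : mkR n ((X 0 : P) ^ (2 * n + 2)) = 0 :=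
    Ideal.Quotient.eq_zero_iff_mem.2 (Ideal.subset_span (by simp))
  simpa [x] using this

theorem v_sq_add (n : ℕ) :
    v n ^ 2 + algebraMap (ZMod 2) (R n) ((n : ZMod 2) + 1) * x n ^ (2 * n) * w n = 0 := by
  have : mkR n ((X 1 : P) ^ 2 + C ((n : ZMod 2) + 1) * (X 0 : P) ^ (2 * n) * X 2) = 0 :=
    Ideal.Quotient.eq_zero_iff_mem.2 (Ideal.subset_span (by simp))
  rw [← MvPolynomial.algebraMap_eq] at this
  rwa [map_add, map_mul, map_mul, map_pow, map_pow, AlgHom.commutes] at this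

/-- The top power of `x` times `v` is not annihilated by any power of `w`. -/
theorem x_pow_mul_v_mul_w_pow_ne_zero (n c : ℕ) :
    x n ^ (2 * n + 1) * v n * w n ^ c ≠ 0 := by
  let f : Polynomial (ZMod 2) := Polynomial.X ^ (2 * n + 2)
  let r : AdjoinRoot f := AdjoinRoot.root f
  have hf : f.Monic := Polynomial.monic_X_pow _
  have hr : r ^ (2 * n + 2) = 0 := by
    exact (map_pow (AdjoinRoot.mk f) Polynomial.X _).symm.trans AdjoinRoot.mk_self
  have hr' : r ^ (2 * n + 1) ≠ 0 := by
    have h : AdjoinRoot.mk f (Polynomial.X ^ (2 * n + 1)) ≠ 0 := by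
      rw [Ne, AdjoinRoot.mk_eq_zero]
      exact hf.not_dvd_of_natDegree_lt (Polynomial.monic_X_pow _).ne_zero (by simp [f])
    simpa [r] using h
  have : Nontrivial (AdjoinRoot f) := ⟨⟨_, _, hr'⟩⟩
  let s : AdjoinRoot f := algebraMap (ZMod 2) _ ((n : ZMod 2) + 1) * r ^ (2 * n)
  let g : Polynomial (AdjoinRoot f) := Polynomial.X ^ 2 + Polynomial.C s
  have hg : g.Monic := Polynomial.monic_X_pow_add_C s two_ne_zero
  have hgroot : AdjoinRoot.root g ^ 2 + AdjoinRoot.of g s = 0 := by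
    have h : AdjoinRoot.mk g (Polynomial.X ^ 2 + Polynomial.C s) = 0 := AdjoinRoot.mk_self
    rw [map_add, map_pow] at h
    exact h
  have hne : AdjoinRoot.of g (r ^ (2 * n + 1)) * AdjoinRoot.root g ≠ 0 := by
    have h : AdjoinRoot.mk g (Polynomial.C (r ^ (2 * n + 1)) * Polynomial.X) ≠ 0 := by
      rw [Ne, AdjoinRoot.mk_eq_zero]
      refine hg.not_dvd_of_natDegree_lt ?_ ?_
      · rwa [Ne, Polynomial.C_mul_X_eq_monomial, Polynomial.monomial_eq_zero_iff]
      · rw [Polynomial.natDegree_C_mul_X _ hr', Polynomial.natDegree_X_pow_add_C]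
        norm_num
    simpa using h
  let φ : P →ₐ[ZMod 2] AdjoinRoot g :=
    MvPolynomial.aeval ![AdjoinRoot.of g r, AdjoinRoot.root g, 1]
  have hφ : relIdeal n ≤ RingHom.ker φ := by
    rw [relIdeal, Ideal.span_le]
    rintro y (rfl | rfl)
    · have h : AdjoinRoot.of g r ^ (2 * n + 2) = 0 := by rw [← map_pow, hr, map_zero]
      simpa only [SetLike.mem_coe, RingHom.mem_ker, map_pow, φ, aeval_X, Matrix.cons_val] using h
    · have h : algebraMap (ZMod 2) (AdjoinRoot g) ((n : ZMod 2) + 1) =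
          AdjoinRoot.of g (algebraMap (ZMod 2) _ ((n : ZMod 2) + 1)) := rfl
      rw [SetLike.mem_coe, RingHom.mem_ker, ← MvPolynomial.algebraMap_eq, map_add, map_mul,
        map_mul, map_pow, map_pow, AlgHom.commutes, h]
      simpa only [s, map_mul, map_pow, φ, aeval_X, Matrix.cons_val, mul_one] using hgroot
  intro h0
  have hmem : (X 0 : P) ^ (2 * n + 1) * X 1 * X 2 ^ c ∈ relIdeal n := by
    rw [← Ideal.Quotient.eq_zero_iff_mem]
    exact h0
  have := hφ hmem
  rw [RingHom.mem_ker] at this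
  apply hne
  simpa [φ] using this

/-- A homogeneous element of `R_g` is a combination of the monomials of `R_g` of its degree. -/
theorem mem_span_of_mem_Rdeg_of_mem_Rg (n : ℕ) (hdisj : Disjoint (Re n) (Rg n)) (d : ℤ) (y : R n)
    (hd : y ∈ Rdeg n d) (hg : y ∈ Rg n) :
    y ∈ Submodule.span (ZMod 2) {y : R n | ∃ a b c : ℕ, a ≤ 2 * n + 1 ∧ b ≤ 1 ∧ Odd (b + c) ∧
      y = x n ^ a * v n ^ b * w n ^ c ∧ -(a : ℤ) + 2 * n * c = d} := by
  set G := Submodule.span (ZMod 2) {y : R n | ∃ a b c : ℕ, a ≤ 2 * n + 1 ∧ b ≤ 1 ∧ Odd (b + c) ∧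
      y = x n ^ a * v n ^ b * w n ^ c ∧ -(a : ℤ) + 2 * n * c = d} with hG
  have hGg : G ≤ Rg n := by
    refine Submodule.span_le.2 ?_
    rintro _ ⟨a, b, c, ha, hb, ⟨k, hk⟩, rfl, -⟩
    interval_cases b
    · exact Submodule.subset_span ⟨a, k, ha, Or.inl (by rw [show c = 2 * k + 1 by lia]; ring)⟩
    · exact Submodule.subset_span ⟨a, k, ha, Or.inr (by rw [show c = 2 * k by lia]; ring)⟩
  have hle : Rdeg n d ≤ Re n ⊔ G := by
    refine Submodule.span_le.2 ?_
    rintro _ ⟨a, b, c, ha, hb, rfl, hd⟩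
    rcases Nat.even_or_odd (b + c) with ⟨k, hk⟩ | hodd
    · refine Submodule.mem_sup_left (Submodule.subset_span ?_)
      interval_cases b
      · exact ⟨a, k, ha, Or.inl (by rw [show c = 2 * k by lia]; ring)⟩
      · exact ⟨a, k - 1, ha, Or.inr (by rw [show c = 2 * (k - 1) + 1 by lia]; ring)⟩
    · exact Submodule.mem_sup_right (Submodule.subset_span ⟨a, b, c, ha, hb, hodd, rfl, hd⟩)
  obtain ⟨e, he, g, hg', rfl⟩ := Submodule.mem_sup.1 (hle hd)
  have he' : e ∈ Rg n := by simpa using (Rg n).sub_mem hg (hGg hg')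
  rw [Submodule.disjoint_def.1 hdisj e he he', zero_add]
  exact hg'

/-- If a degree of `R_g` contains at most two monomials, its elements are the combinations of these
two with coefficients `0` and `1`. -/
theorem exists_coefficients (n : ℕ) (hdisj : Disjoint (Re n) (Rg n)) (d : ℤ) (y m₁ m₂ : R n)
    (hd : y ∈ Rdeg n d) (hg : y ∈ Rg n)
    (hm : ∀ a b c : ℕ, a ≤ 2 * n + 1 → b ≤ 1 → Odd (b + c) → -(a : ℤ) + 2 * n * c = d →
      x n ^ a * v n ^ b * w n ^ c = m₁ ∨ x n ^ a * v n ^ b * w n ^ c = m₂) :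
    ∃ s t : R n, (s = 0 ∨ s = 1) ∧ (t = 0 ∨ t = 1) ∧ y = s * m₁ + t * m₂ := by
  have hle : Submodule.span (ZMod 2) {y : R n | ∃ a b c : ℕ, a ≤ 2 * n + 1 ∧ b ≤ 1 ∧
      Odd (b + c) ∧ y = x n ^ a * v n ^ b * w n ^ c ∧ -(a : ℤ) + 2 * n * c = d} ≤
      Submodule.span (ZMod 2) {m₁, m₂} := by
    refine Submodule.span_mono ?_
    rintro _ ⟨a, b, c, ha, hb, hodd, rfl, hd⟩
    exact hm a b c ha hb hodd hd
  obtain ⟨s, t, rfl⟩ :=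
    Submodule.mem_span_pair.1 (hle (mem_span_of_mem_Rdeg_of_mem_Rg n hdisj d y hd hg))
  have hbit : ∀ s : ZMod 2, s = 0 ∨ s = 1 := by decide
  rcases hbit s with rfl | rfl <;> rcases hbit t with rfl | rfl
  · exact ⟨0, 0, by simp⟩
  · exact ⟨0, 1, by simp⟩
  · exact ⟨1, 0, by simp⟩
  · exact ⟨1, 1, by simp⟩

/-- In degrees at most `2 * k + 3`, the monomials `x ^ a * v ^ b * w ^ c` of `R_g` have `c ≤ 3`. -/
theorem exponents_of_degree_le {k a b c : ℕ} {d : ℤ} (ha : a ≤ 2 * (k + 1) + 1) (hb : b ≤ 1)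
    (hodd : Odd (b + c)) (hd : -(a : ℤ) + 2 * (k + 1 : ℕ) * c = d) (hd' : d ≤ 2 * k + 3) :
    b = 0 ∧ c = 1 ∨ b = 0 ∧ c = 3 ∨ b = 1 ∧ c = 0 ∨ b = 1 ∧ c = 2 := by
  obtain ⟨j, hj⟩ := hodd
  have hc : c < 4 := by
    by_contra! hc
    push_cast at hd
    have hc' : (4 : ℤ) ≤ c := by exact_mod_cast hc
    nlinarith [mul_le_mul_of_nonneg_left hc' (show (0 : ℤ) ≤ k by positivity)]
  lia

/-- Case (B) of Theorem 4.1: if `(R, Δ)` is a char-2 B-V datum, `R = R_e ⊕ R_g`,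
`Δ` is homogeneous of degree `+1`, `Δ` vanishes on `R_e`, `Δ(R_g) ⊆ R_g`, and
`Δ(x^{2n+1} v) = x^{2n} v`, then `Δ x = Δ v = Δ w = 0`, `⁅x,v⁆ = v`, `⁅v,w⁆ = 0`,
and `⁅x,w⁆ = w` or `⁅x,w⁆ = w + x^{2n} v w²`. -/
theorem stmt_16 (n : ℕ) (hn : 1 ≤ n)
    (Δ : R n → R n) (hΔadd : ∀ a b : R n, Δ (a + b) = Δ a + Δ b)
    (hΔΔ : ∀ a : R n, Δ (Δ a) = 0)
    (br : R n → R n → R n)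
    (hbr : ∀ a b : R n, br a b = Δ (a * b) + Δ a * b + a * Δ b)
    (halt : ∀ a : R n, br a a = 0)
    (hleib : ∀ a b c : R n, br a (b * c) = br a b * c + b * br a c)
    (hcompl : IsCompl (Re n) (Rg n))
    (hΔdeg : ∀ (d : ℤ) (y : R n), y ∈ Rdeg n d → Δ y ∈ Rdeg n (d + 1))
    (hΔe : ∀ y ∈ Re n, Δ y = 0)
    (hΔg : ∀ y ∈ Rg n, Δ y ∈ Rg n)
    (hkey : Δ (x n ^ (2 * n + 1) * v n) = x n ^ (2 * n) * v n) :
    Δ (x n) = 0 ∧ Δ (v n) = 0 ∧ Δ (w n) = 0 ∧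
    br (x n) (v n) = v n ∧ br (v n) (w n) = 0 ∧
    (br (x n) (w n) = w n ∨
      br (x n) (w n) = w n + x n ^ (2 * n) * v n * w n ^ 2) := by
  obtain ⟨k, rfl⟩ : ∃ k, n = k + 1 := ⟨n - 1, by omega⟩
  have hdisj := hcompl.disjoint
  have e₁ : 2 * (k + 1) = 2 * k + 2 := by ring
  have e₂ : 2 * (k + 1) + 1 = 2 * k + 3 := by ring
  have hxn : x (k + 1) ^ (2 * k + 4) = 0 := by
    rw [show 2 * k + 4 = 2 * (k + 1) + 2 by ring, x_pow_eq_zero]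
  have hne : ∀ c : ℕ, x (k + 1) ^ (2 * k + 3) * v (k + 1) * w (k + 1) ^ c ≠ 0 := fun c => by
    rw [← e₂]; exact x_pow_mul_v_mul_w_pow_ne_zero (k + 1) c
  have h2 : (2 : R (k + 1)) = 0 := by
    have : algebraMap (ZMod 2) (R (k + 1)) 2 = 0 := by
      rw [show (2 : ZMod 2) = 0 from rfl, map_zero]
    simpa only [map_ofNat] using this
  have hv : x (k + 1) ^ (2 * k + 2) * v (k + 1) ^ 2 = 0 := by
    have h := v_sq_add (k + 1)
    set s := algebraMap (ZMod 2) (R (k + 1)) (((k + 1 : ℕ) : ZMod 2) + 1)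
    linear_combination x (k + 1) ^ (2 * k + 2) * h - s * x (k + 1) ^ (2 * k) * w (k + 1) * hxn
  have hΔx : Δ (x (k + 1)) = 0 :=
    hΔe _ (Submodule.subset_span ⟨1, 0, by omega, Or.inl (by ring)⟩)
  have hΔvw : Δ (v (k + 1) * w (k + 1)) = 0 :=
    hΔe _ (Submodule.subset_span ⟨0, 0, by omega, Or.inr (by ring)⟩)
  have hΔxvw : Δ (x (k + 1) * (v (k + 1) * w (k + 1))) = 0 :=
    hΔe _ (Submodule.subset_span ⟨1, 0, by omega, Or.inr (by ring)⟩)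
  rw [e₂, e₁] at hkey
  rw [e₁]
  refine ⟨hΔx, bv_operator_of_coefficients h2 (x (k + 1)) (v (k + 1)) (w (k + 1)) k hxn hv
    hne Δ hΔadd hΔΔ br hbr halt hleib hΔx hΔvw hΔxvw hkey
    (exists_coefficients (k + 1) hdisj (0 + 1) _ _ _
      (hΔdeg _ _ (Submodule.subset_span ⟨0, 1, 0, by omega, by omega, by ring, by simp⟩))
      (hΔg _ (Submodule.subset_span ⟨0, 0, by omega, Or.inr (by ring)⟩)) ?_)
    (exists_coefficients (k + 1) hdisj (2 * (k + 1) + 1) _ _ _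
      (hΔdeg _ _ (Submodule.subset_span ⟨0, 0, 1, by omega, by omega, by ring, by simp⟩))
      (hΔg _ (Submodule.subset_span ⟨0, 0, by omega, Or.inl (by ring)⟩)) ?_)
    (exists_coefficients (k + 1) hdisj (-1 + 1) _ _ _
      (hΔdeg _ _ (Submodule.subset_span ⟨1, 1, 0, by omega, by omega, by ring, by simp⟩))
      (hΔg _ (Submodule.subset_span ⟨1, 0, by omega, Or.inr (by ring)⟩)) ?_)
    (exists_coefficients (k + 1) hdisj (2 * (k + 1) - 1 + 1) _ _ _
      (hΔdeg _ _ (Submodule.subset_span ⟨1, 0, 1, by omega, by omega, by ring, by push_cast; ring⟩))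
      (hΔg _ (Submodule.subset_span ⟨1, 0, by omega, Or.inl (by ring)⟩)) ?_)⟩
  · intro a b c ha hb hodd hd
    obtain ⟨rfl, rfl⟩ | ⟨rfl, rfl⟩ | ⟨rfl, rfl⟩ | ⟨rfl, rfl⟩ :=
      exponents_of_degree_le ha hb hodd hd (by omega) <;> push_cast at hd
    · left; rw [show a = 2 * k + 1 by omega]; ring
    · omega
    · omega
    · right; rw [show a = 2 * k + 3 by omega]; ring
  · intro a b c ha hb hodd hd
    obtain ⟨rfl, rfl⟩ | ⟨rfl, rfl⟩ | ⟨rfl, rfl⟩ | ⟨rfl, rfl⟩ :=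
      exponents_of_degree_le ha hb hodd hd (by omega) <;> push_cast at hd
    · omega
    · right; rw [show a = 2 * k + 3 by omega]; ring
    · omega
    · left; rw [show a = 2 * k + 1 by omega]; ring
  · intro a b c ha hb hodd hd
    obtain ⟨rfl, rfl⟩ | ⟨rfl, rfl⟩ | ⟨rfl, rfl⟩ | ⟨rfl, rfl⟩ :=
      exponents_of_degree_le ha hb hodd hd (by omega) <;> push_cast at hd
    · right; rw [show a = 2 * k + 2 by omega]; ring
    · omega
    · left; rw [show a = 0 by omega]; ring
    · omega
  · intro a b c ha hb hodd hd
    obtain ⟨rfl, rfl⟩ | ⟨rfl, rfl⟩ | ⟨rfl, rfl⟩ | ⟨rfl, rfl⟩ :=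
      exponents_of_degree_le ha hb hodd hd (by omega) <;> push_cast at hd
    · left; rw [show a = 0 by omega]; ring
    · omega
    · omega
    · right; rw [show a = 2 * k + 2 by omega]; ring


end
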